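/- arXiv:1708.01418 — 2 statements merged into one kernel-verified Lean document; each statement's English description precedes it below -/
import Mathlib

section
/- Commutator formula for the elliptic raising and lowering operators on the Grassmannian (core of the §8 Proposition, part (1), for 𝔰𝔩₂): let ϑ : ℂ → ℂ be an odd function, ħ ∈ ℂ, and w ≥ 2, 1 ≤ v ≤ w−1. Let t₁,…,t_w ∈ ℂ with ϑ(t_k − t_m) ≠ 0 for all k ≠ m and ϑ(ħ) ≠ 0. For g : ℂ → ℂ and a function F of (t₁,…,t_w) that is symmetric separately in its first a variables and its last w−a variables, define (x⁺_g F)(t₁,…,t_w) := ∑_{k=a}^{w} F(t₁,…,t_{a−1}, t_k; t_a,…,t̂_k,…,t_w)·g(t_k)·∏_{m∈[a,w], m≠k} ϑ(t_k−t_m+ħ)/ϑ(t_k−t_m) (an operator from split-(a) functions to split-(a−1) functions), and (x⁻_g F)(t₁,…,t_w) := ∑_{k=1}^{a+1} F(t₁,…,t̂_k,…,t_{a+1}; t_k, t_{a+2},…,t_w)·g(t_k)·∏_{m∈[1,a+1], m≠k} ϑ(t_m−t_k+ħ)/ϑ(t_m−t_k) (an operator from split-(a) functions to split-(a+1) functions).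 Then for any g₁, g₂ : ℂ → ℂ and any f symmetric separately in (t₁,…,t_v) and (t_{v+1},…,t_w): (x⁺_{g₂}(x⁻_{g₁} f))(t) − (x⁻_{g₁}(x⁺_{g₂} f))(t) = ∑_{k=1}^{w} f(t)·g₁(t_k)·g₂(t_k)·[ ∏_{m=1}^{v} ϑ(t_k−t_m−ħ) · ∏_{m=v+1}^{w} ϑ(t_k−t_m+ħ) ] / [ ϑ(ħ)·∏_{m≠k} ϑ(t_k−t_m) ]. -/
noncomputable section

open Finset

/-- A function of `w` complex variables that is symmetric separately in its first `a`
variables and its last `w − a` variables. -/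
def SplitSymm (w a : ℕ) (F : (Fin w → ℂ) → ℂ) : Prop :=
  ∀ σ : Equiv.Perm (Fin w),
    (∀ j : Fin w, (j : ℕ) < a ↔ ((σ j : ℕ) < a)) →
    ∀ t : Fin w → ℂ, F (t ∘ σ) = F t

/-- The rearranged tuple `(t₁,…,t_{a−1}, t_k; t_a,…,t̂_k,…,t_w)` (0-indexed: positions
`< a−1` keep `t_j`, position `a−1` gets `t_k`, and positions `≥ a` enumerate
`t_{a−1},…,t_{w−1}` omitting `t_k` in order). -/
def plusTuple {w : ℕ} (a : ℕ) (k : Fin w) (t : Fin w → ℂ) : Fin w → ℂ :=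
  fun j =>
    if (j : ℕ) + 1 < a then t j
    else if (j : ℕ) + 1 = a then t k
    else if h : (j : ℕ) - 1 < (k : ℕ) then t ⟨(j : ℕ) - 1, Nat.lt_trans h k.isLt⟩
    else t j

/-- The raising operator `x⁺_g` from split-`a` functions to split-`(a−1)` functions:
`(x⁺_g F)(t) = ∑_{k=a}^{w} F(t₁,…,t_{a−1},t_k; t_a,…,t̂_k,…,t_w)·g(t_k)·
∏_{m∈[a,w], m≠k} ϑ(t_k−t_m+hbar)/ϑ(t_k−t_m)` (written 0-indexed). -/
def xPlus (ϑ : ℂ → ℂ) (hbar : ℂ) {w : ℕ} (a : ℕ) (g : ℂ → ℂ)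
    (F : (Fin w → ℂ) → ℂ) : (Fin w → ℂ) → ℂ :=
  fun t =>
    ∑ k ∈ Finset.univ.filter (fun k : Fin w => a ≤ (k : ℕ) + 1),
      F (plusTuple a k t) * g (t k) *
        ∏ m ∈ Finset.univ.filter (fun m : Fin w => a ≤ (m : ℕ) + 1 ∧ m ≠ k),
          ϑ (t k - t m + hbar) / ϑ (t k - t m)

/-- The rearranged tuple `(t₁,…,t̂_k,…,t_{a+1}; t_k, t_{a+2},…,t_w)` (0-indexed:
positions `< a` enumerate `t₀,…,t_a` omitting `t_k` in order, position `a` gets `t_k`,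
the rest keep `t_j`). -/
def minusTuple {w : ℕ} (a : ℕ) (k : Fin w) (t : Fin w → ℂ) : Fin w → ℂ :=
  fun j =>
    if (j : ℕ) < a then
      (if (j : ℕ) < (k : ℕ) then t j
       else if h : (j : ℕ) + 1 < w then t ⟨(j : ℕ) + 1, h⟩ else t k)
    else if (j : ℕ) = a then t k
    else t j

/-- The lowering operator `x⁻_g` from split-`a` functions to split-`(a+1)` functions:
`(x⁻_g F)(t) = ∑_{k=1}^{a+1} F(t₁,…,t̂_k,…,t_{a+1}; t_k, t_{a+2},…,t_w)·g(t_k)·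
∏_{m∈[1,a+1], m≠k} ϑ(t_m−t_k+hbar)/ϑ(t_m−t_k)` (written 0-indexed). -/
def xMinus (ϑ : ℂ → ℂ) (hbar : ℂ) {w : ℕ} (a : ℕ) (g : ℂ → ℂ)
    (F : (Fin w → ℂ) → ℂ) : (Fin w → ℂ) → ℂ :=
  fun t =>
    ∑ k ∈ Finset.univ.filter (fun k : Fin w => (k : ℕ) < a + 1),
      F (minusTuple a k t) * g (t k) *
        ∏ m ∈ Finset.univ.filter (fun m : Fin w => (m : ℕ) < a + 1 ∧ m ≠ k),
          ϑ (t m - t k + hbar) / ϑ (t m - t k)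

/-- The map of indices underlying `plusTuple`. -/
def plusIndex {w : ℕ} (a : ℕ) (k : Fin w) : Fin w → Fin w :=
  fun j =>
    if (j : ℕ) + 1 < a then j
    else if (j : ℕ) + 1 = a then k
    else if h : (j : ℕ) - 1 < (k : ℕ) then ⟨(j : ℕ) - 1, Nat.lt_trans h k.isLt⟩
    else j

/-- The map of indices underlying `minusTuple`. -/
def minusIndex {w : ℕ} (a : ℕ) (k : Fin w) : Fin w → Fin w :=
  fun j =>
    if (j : ℕ) < a then
      (if (j : ℕ) < (k : ℕ) then j
       else if h : (j : ℕ) + 1 < w then ⟨(j : ℕ) + 1, h⟩ else k)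
    else if (j : ℕ) = a then k
    else j

lemma plusTuple_eq_comp {w : ℕ} (a : ℕ) (k : Fin w) (t : Fin w → ℂ) :
    plusTuple a k t = t ∘ plusIndex a k := by
  funext j
  simp only [plusTuple, plusIndex, Function.comp_apply]
  split_ifs <;> rfl

lemma minusTuple_eq_comp {w : ℕ} (a : ℕ) (k : Fin w) (t : Fin w → ℂ) :
    minusTuple a k t = t ∘ minusIndex a k := by
  funext j
  simp only [minusTuple, minusIndex, Function.comp_apply]
  split_ifs <;> rfl

lemma val_plusIndex {w : ℕ} (a : ℕ) (k j : Fin w) :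
    (plusIndex a k j : ℕ) =
      if (j : ℕ) + 1 < a then (j : ℕ) else if (j : ℕ) + 1 = a then (k : ℕ)
      else if (j : ℕ) - 1 < (k : ℕ) then (j : ℕ) - 1 else (j : ℕ) := by
  simp only [plusIndex]
  split_ifs <;> rfl

lemma val_minusIndex {w : ℕ} (a : ℕ) (k j : Fin w) :
    (minusIndex a k j : ℕ) =
      if (j : ℕ) < a then
        (if (j : ℕ) < (k : ℕ) then (j : ℕ)
         else if (j : ℕ) + 1 < w then (j : ℕ) + 1 else (k : ℕ))
      else if (j : ℕ) = a then (k : ℕ) else (j : ℕ) := by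
  simp only [minusIndex]
  split_ifs <;> rfl

lemma plusIndex_injective {w a : ℕ} {k : Fin w} (ha : 1 ≤ a) (hk : a ≤ (k : ℕ) + 1) :
    Function.Injective (plusIndex a k) := by
  intro i j h
  have h' := congrArg Fin.val h
  rw [val_plusIndex, val_plusIndex] at h'
  apply Fin.ext
  split_ifs at h' <;> omega

lemma minusIndex_injective {w a : ℕ} {k : Fin w} (ha : a < w) (hk : (k : ℕ) ≤ a) :
    Function.Injective (minusIndex a k) := by
  intro i j h
  have h' := congrArg Fin.val h
  rw [val_minusIndex, val_minusIndex] at h'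
  apply Fin.ext
  split_ifs at h' <;> omega

lemma SplitSymm.comp_eq {w a : ℕ} {F : (Fin w → ℂ) → ℂ} (hF : SplitSymm w a F)
    (t : Fin w → ℂ) {u : Fin w → Fin w} (hu : Function.Injective u) (β : Equiv.Perm (Fin w))
    (h : ∀ j : Fin w, (j : ℕ) < a ↔ (β.symm (u j) : ℕ) < a) :
    F (t ∘ u) = F (t ∘ β) := by
  have hb : Function.Bijective u := Finite.injective_iff_bijective.mp hu
  have := hF ((Equiv.ofBijective u hb).trans β.symm) h (t ∘ β)
  rw [← this]
  congr 1
  funext j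
  simp

lemma val_swap {w : ℕ} (l k j : Fin w) :
    (Equiv.swap l k j : ℕ) =
      if (j : ℕ) = l then (k : ℕ) else if (j : ℕ) = k then (l : ℕ) else (j : ℕ) := by
  simp only [Equiv.swap_apply_def, Fin.ext_iff]
  split_ifs <;> rfl

lemma SplitSymm.apply_plus_minus_swap {w v : ℕ} {f : (Fin w → ℂ) → ℂ} (hf : SplitSymm w v f)
    (t : Fin w → ℂ) {k l : Fin w} (hk : v ≤ (k : ℕ)) (hl : (l : ℕ) < v) :
    f (minusTuple v l (plusTuple (v + 1) k t)) = f (t ∘ Equiv.swap l k) := by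
  rw [minusTuple_eq_comp, plusTuple_eq_comp, Function.comp_assoc]
  refine hf.comp_eq t ((plusIndex_injective (by omega) (by omega)).comp
    (minusIndex_injective (by omega) hl.le)) _ fun j => ?_
  simp only [Equiv.symm_swap, val_swap, Function.comp_apply, val_plusIndex, val_minusIndex]
  split_ifs <;> omega

lemma SplitSymm.apply_minus_plus_swap {w v : ℕ} {f : (Fin w → ℂ) → ℂ} (hf : SplitSymm w v f)
    (t : Fin w → ℂ) {k l : Fin w} (hk : v ≤ (k : ℕ)) (hl : (l : ℕ) < v) :
    f (plusTuple v k (minusTuple (v - 1) l t)) = f (t ∘ Equiv.swap l k) := by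
  rw [minusTuple_eq_comp, plusTuple_eq_comp, Function.comp_assoc]
  refine hf.comp_eq t ((minusIndex_injective (by omega) (by omega)).comp
    (plusIndex_injective (by omega) (by omega))) _ fun j => ?_
  simp only [Equiv.symm_swap, val_swap, Function.comp_apply, val_plusIndex, val_minusIndex]
  split_ifs <;> omega

lemma SplitSymm.apply_plus_minus_self {w v : ℕ} {f : (Fin w → ℂ) → ℂ} (hf : SplitSymm w v f)
    (t : Fin w → ℂ) {k n : Fin w} (hk : v ≤ (k : ℕ)) (hn : (n : ℕ) = v) :
    f (minusTuple v n (plusTuple (v + 1) k t)) = f t := by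
  rw [minusTuple_eq_comp, plusTuple_eq_comp, Function.comp_assoc]
  refine hf.comp_eq t ((plusIndex_injective (by omega) (by omega)).comp
    (minusIndex_injective (by omega) hn.le)) (Equiv.refl _) fun j => ?_
  simp only [Equiv.refl_symm, Equiv.refl_apply, Function.comp_apply, val_plusIndex,
    val_minusIndex]
  split_ifs <;> omega

lemma SplitSymm.apply_minus_plus_self {w v : ℕ} {f : (Fin w → ℂ) → ℂ} (hf : SplitSymm w v f)
    (t : Fin w → ℂ) {l n : Fin w} (hl : (l : ℕ) < v) (hn : (n : ℕ) + 1 = v) :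
    f (plusTuple v n (minusTuple (v - 1) l t)) = f t := by
  rw [minusTuple_eq_comp, plusTuple_eq_comp, Function.comp_assoc]
  refine hf.comp_eq t ((minusIndex_injective (by omega) (by omega)).comp
    (plusIndex_injective (by omega) (by omega))) (Equiv.refl _) fun j => ?_
  simp only [Equiv.refl_symm, Equiv.refl_apply, Function.comp_apply, val_plusIndex,
    val_minusIndex]
  split_ifs <;> omega

lemma xMinus_plusTuple (ϑ : ℂ → ℂ) (hbar : ℂ) {w v : ℕ} (g : ℂ → ℂ) {f : (Fin w → ℂ) → ℂ}
    (hf : SplitSymm w v f) (t : Fin w → ℂ) {k : Fin w} (hk : v ≤ (k : ℕ)) :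
    xMinus ϑ hbar v g f (plusTuple (v + 1) k t) =
      f t * g (t k) * ∏ m ∈ univ.filter (fun m : Fin w => (m : ℕ) < v),
          ϑ (t m - t k + hbar) / ϑ (t m - t k)
      + ∑ l ∈ univ.filter (fun l : Fin w => (l : ℕ) < v),
          f (t ∘ Equiv.swap l k) * g (t l) *
            (ϑ (t k - t l + hbar) / ϑ (t k - t l) *
              ∏ m ∈ univ.filter (fun m : Fin w => (m : ℕ) < v ∧ m ≠ l),
                ϑ (t m - t l + hbar) / ϑ (t m - t l)) := by
  obtain ⟨n, hn⟩ : ∃ n : Fin w, (n : ℕ) = v := ⟨⟨v, by omega⟩, rfl⟩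
  have tn : plusTuple (v + 1) k t n = t k := by simp [plusTuple, hn]
  have tlt : ∀ m : Fin w, (m : ℕ) < v → plusTuple (v + 1) k t m = t m := fun m hm => by
    simp [plusTuple, hm]
  have hset : univ.filter (fun l : Fin w => (l : ℕ) < v + 1) =
      insert n (univ.filter (fun l : Fin w => (l : ℕ) < v)) := by
    ext m; simp only [mem_filter, mem_insert, mem_univ, true_and, Fin.ext_iff]; omega
  rw [xMinus, hset, sum_insert (by simp [hn])]
  congr 1
  · rw [hf.apply_plus_minus_self t hk hn, tn]
    congr 1
    refine prod_congr ?_ fun m hm => ?_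
    · ext m; simp only [mem_filter, mem_univ, true_and, ne_eq, Fin.ext_iff]; omega
    · rw [tlt m (by simpa using hm)]
  · refine sum_congr rfl fun l hl => ?_
    have hl' : (l : ℕ) < v := by simpa using hl
    have hset' : univ.filter (fun m : Fin w => (m : ℕ) < v + 1 ∧ m ≠ l) =
        insert n (univ.filter (fun m : Fin w => (m : ℕ) < v ∧ m ≠ l)) := by
      ext m; simp only [mem_filter, mem_insert, mem_univ, true_and, ne_eq, Fin.ext_iff]; omega
    rw [hf.apply_plus_minus_swap t hk hl', hset', prod_insert (by simp [hn]), tn, tlt l hl']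
    congr 2
    refine prod_congr rfl fun m hm => ?_
    rw [tlt m (mem_filter.mp hm).2.1]

lemma xPlus_minusTuple (ϑ : ℂ → ℂ) (hbar : ℂ) {w v : ℕ} (g : ℂ → ℂ) {f : (Fin w → ℂ) → ℂ}
    (hf : SplitSymm w v f) (t : Fin w → ℂ) {l : Fin w} (hvw : v ≤ w) (hl : (l : ℕ) < v) :
    xPlus ϑ hbar v g f (minusTuple (v - 1) l t) =
      f t * g (t l) * ∏ m ∈ univ.filter (fun m : Fin w => v ≤ (m : ℕ)),
          ϑ (t l - t m + hbar) / ϑ (t l - t m)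
      + ∑ k ∈ univ.filter (fun k : Fin w => v ≤ (k : ℕ)),
          f (t ∘ Equiv.swap l k) * g (t k) *
            (ϑ (t k - t l + hbar) / ϑ (t k - t l) *
              ∏ m ∈ univ.filter (fun m : Fin w => v ≤ (m : ℕ) ∧ m ≠ k),
                ϑ (t k - t m + hbar) / ϑ (t k - t m)) := by
  obtain ⟨n, hn⟩ : ∃ n : Fin w, (n : ℕ) + 1 = v := ⟨⟨v - 1, by omega⟩, by simp; omega⟩
  have tn : minusTuple (v - 1) l t n = t l := by
    rw [minusTuple, if_neg (by omega), if_pos (by omega)]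
  have tge : ∀ m : Fin w, v ≤ (m : ℕ) → minusTuple (v - 1) l t m = t m := fun m hm => by
    rw [minusTuple, if_neg (by omega), if_neg (by omega)]
  have hset : univ.filter (fun l : Fin w => v ≤ (l : ℕ) + 1) =
      insert n (univ.filter (fun l : Fin w => v ≤ (l : ℕ))) := by
    ext m; simp only [mem_filter, mem_insert, mem_univ, true_and, Fin.ext_iff]; omega
  rw [xPlus, hset, sum_insert (by simp; omega)]
  congr 1
  · rw [hf.apply_minus_plus_self t hl hn, tn]
    congr 1
    refine prod_congr ?_ fun m hm => ?_
    · ext m; simp only [mem_filter, mem_univ, true_and, ne_eq, Fin.ext_iff]; omega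
    · rw [tge m (by simpa using hm)]
  · refine sum_congr rfl fun k hk => ?_
    have hk' : v ≤ (k : ℕ) := by simpa using hk
    have hset' : univ.filter (fun m : Fin w => v ≤ (m : ℕ) + 1 ∧ m ≠ k) =
        insert n (univ.filter (fun m : Fin w => v ≤ (m : ℕ) ∧ m ≠ k)) := by
      ext m; simp only [mem_filter, mem_insert, mem_univ, true_and, ne_eq, Fin.ext_iff]; omega
    rw [hf.apply_minus_plus_swap t hk' hl, hset',
      prod_insert (by simp only [mem_filter]; omega), tn, tge k hk']
    congr 2
    refine prod_congr rfl fun m hm => ?_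
    rw [tge m (mem_filter.mp hm).2.1]

lemma odd_ratio_swap {ϑ : ℂ → ℂ} (hϑ : ∀ z : ℂ, ϑ (-z) = -ϑ z) (x y hbar : ℂ) :
    ϑ (x - y + hbar) / ϑ (x - y) = ϑ (y - x - hbar) / ϑ (y - x) := by
  rw [show x - y + hbar = -(y - x - hbar) by ring, show x - y = -(y - x) by ring, hϑ, hϑ,
    neg_div_neg_eq]

lemma cartan_term_of_le {ϑ : ℂ → ℂ} (hϑ : ∀ z : ℂ, ϑ (-z) = -ϑ z) {hbar : ℂ}
    (hhbar : ϑ hbar ≠ 0) {w v : ℕ} (t : Fin w → ℂ) {k : Fin w} (hk : v ≤ (k : ℕ)) :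
    ((∏ m ∈ univ.filter (fun m : Fin w => (m : ℕ) < v), ϑ (t k - t m - hbar)) *
        ∏ m ∈ univ.filter (fun m : Fin w => v ≤ (m : ℕ)), ϑ (t k - t m + hbar)) /
      (ϑ hbar * ∏ m ∈ univ.erase k, ϑ (t k - t m)) =
    (∏ m ∈ univ.filter (fun m : Fin w => (m : ℕ) < v), ϑ (t m - t k + hbar) / ϑ (t m - t k)) *
      ∏ m ∈ univ.filter (fun m : Fin w => v ≤ (m : ℕ) ∧ m ≠ k),
        ϑ (t k - t m + hbar) / ϑ (t k - t m) := by
  have h1 : univ.filter (fun m : Fin w => v ≤ (m : ℕ)) =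
      insert k (univ.filter (fun m : Fin w => v ≤ (m : ℕ) ∧ m ≠ k)) := by
    ext m; simp only [mem_filter, mem_insert, mem_univ, true_and, ne_eq, Fin.ext_iff]; omega
  have h2 : univ.erase k = univ.filter (fun m : Fin w => (m : ℕ) < v) ∪
      univ.filter (fun m : Fin w => v ≤ (m : ℕ) ∧ m ≠ k) := by
    ext m
    simp only [mem_filter, mem_union, mem_erase, mem_univ, true_and, and_true, ne_eq,
      Fin.ext_iff]
    omega
  have h3 : Disjoint (univ.filter (fun m : Fin w => (m : ℕ) < v))
      (univ.filter (fun m : Fin w => v ≤ (m : ℕ) ∧ m ≠ k)) := by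
    rw [disjoint_filter]; intros; omega
  simp_rw [odd_ratio_swap hϑ _ (t k)]
  rw [h1, h2, prod_union h3, prod_insert (by simp), prod_div_distrib, prod_div_distrib, sub_self,
    zero_add, div_mul_div_comm, mul_left_comm, mul_div_mul_left _ _ hhbar]

lemma cartan_term_of_lt {ϑ : ℂ → ℂ} (hϑ : ∀ z : ℂ, ϑ (-z) = -ϑ z) {hbar : ℂ}
    (hhbar : ϑ hbar ≠ 0) {w v : ℕ} (t : Fin w → ℂ) {k : Fin w} (hk : (k : ℕ) < v) :
    ((∏ m ∈ univ.filter (fun m : Fin w => (m : ℕ) < v), ϑ (t k - t m - hbar)) *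
        ∏ m ∈ univ.filter (fun m : Fin w => v ≤ (m : ℕ)), ϑ (t k - t m + hbar)) /
      (ϑ hbar * ∏ m ∈ univ.erase k, ϑ (t k - t m)) =
    -((∏ m ∈ univ.filter (fun m : Fin w => (m : ℕ) < v ∧ m ≠ k),
        ϑ (t m - t k + hbar) / ϑ (t m - t k)) *
      ∏ m ∈ univ.filter (fun m : Fin w => v ≤ (m : ℕ)),
        ϑ (t k - t m + hbar) / ϑ (t k - t m)) := by
  have h1 : univ.filter (fun m : Fin w => (m : ℕ) < v) =
      insert k (univ.filter (fun m : Fin w => (m : ℕ) < v ∧ m ≠ k)) := by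
    ext m; simp only [mem_filter, mem_insert, mem_univ, true_and, ne_eq, Fin.ext_iff]; omega
  have h2 : univ.erase k = univ.filter (fun m : Fin w => (m : ℕ) < v ∧ m ≠ k) ∪
      univ.filter (fun m : Fin w => v ≤ (m : ℕ)) := by
    ext m
    simp only [mem_filter, mem_union, mem_erase, mem_univ, true_and, and_true, ne_eq,
      Fin.ext_iff]
    omega
  have h3 : Disjoint (univ.filter (fun m : Fin w => (m : ℕ) < v ∧ m ≠ k))
      (univ.filter (fun m : Fin w => v ≤ (m : ℕ))) := by
    rw [disjoint_filter]; intros; omega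
  simp_rw [odd_ratio_swap hϑ _ (t k)]
  rw [h1, h2, prod_union h3, prod_insert (by simp), prod_div_distrib, prod_div_distrib, sub_self,
    zero_sub, hϑ, div_mul_div_comm, neg_mul, neg_mul, neg_div, mul_assoc,
    mul_div_mul_left _ _ hhbar]

/-- Commutator formula for the elliptic raising and lowering operators on the
Grassmannian (core of the §8 Proposition, part (1), for `𝔰𝔩₂`): the commutator
`x⁺_{g₂} x⁻_{g₁} − x⁻_{g₁} x⁺_{g₂}` acts on a split-`v` symmetric function `f` as the
diagonal (Cartan) operator. -/
theorem raising_lowering_commutator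
    (ϑ : ℂ → ℂ) (hϑ_odd : ∀ z : ℂ, ϑ (-z) = -ϑ z) (hbar : ℂ)
    (w v : ℕ) (hw : 2 ≤ w) (hv1 : 1 ≤ v) (hv2 : v ≤ w - 1)
    (t : Fin w → ℂ)
    (hne : ∀ k m : Fin w, k ≠ m → ϑ (t k - t m) ≠ 0) (hhbar : ϑ hbar ≠ 0)
    (g₁ g₂ : ℂ → ℂ)
    (f : (Fin w → ℂ) → ℂ) (hf : SplitSymm w v f) :
    xPlus ϑ hbar (v + 1) g₂ (xMinus ϑ hbar v g₁ f) t
      - xMinus ϑ hbar (v - 1) g₁ (xPlus ϑ hbar v g₂ f) t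
    = ∑ k : Fin w,
        f t * g₁ (t k) * g₂ (t k) *
          ((∏ m ∈ Finset.univ.filter (fun m : Fin w => (m : ℕ) < v),
              ϑ (t k - t m - hbar)) *
            ∏ m ∈ Finset.univ.filter (fun m : Fin w => v ≤ (m : ℕ)),
              ϑ (t k - t m + hbar)) /
          (ϑ hbar * ∏ m ∈ Finset.univ.erase k, ϑ (t k - t m)) := by
  have hplus : xPlus ϑ hbar (v + 1) g₂ (xMinus ϑ hbar v g₁ f) t =
      ∑ k ∈ univ.filter (fun k : Fin w => v ≤ (k : ℕ)),
        xMinus ϑ hbar v g₁ f (plusTuple (v + 1) k t) * g₂ (t k) *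
          ∏ m ∈ univ.filter (fun m : Fin w => v ≤ (m : ℕ) ∧ m ≠ k),
            ϑ (t k - t m + hbar) / ϑ (t k - t m) := by
    simp only [xPlus, Nat.add_le_add_iff_right]
  have hminus : xMinus ϑ hbar (v - 1) g₁ (xPlus ϑ hbar v g₂ f) t =
      ∑ l ∈ univ.filter (fun l : Fin w => (l : ℕ) < v),
        xPlus ϑ hbar v g₂ f (minusTuple (v - 1) l t) * g₁ (t l) *
          ∏ m ∈ univ.filter (fun m : Fin w => (m : ℕ) < v ∧ m ≠ l),
            ϑ (t m - t l + hbar) / ϑ (t m - t l) := by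
    simp only [xMinus, Nat.sub_add_cancel hv1]
  rw [hplus, hminus,
    sum_congr rfl fun k hk => by rw [xMinus_plusTuple ϑ hbar g₁ hf t (mem_filter.mp hk).2],
    sum_congr (s₁ := univ.filter (fun l : Fin w => (l : ℕ) < v)) rfl fun l hl => by
      rw [xPlus_minusTuple ϑ hbar g₂ hf t (by omega) (mem_filter.mp hl).2]]
  simp only [add_mul, sum_add_distrib, sum_mul]
  rw [sum_comm (s := univ.filter (fun l : Fin w => (l : ℕ) < v)), add_sub_add_comm,
    ← sum_sub_distrib (s := univ.filter (fun k : Fin w => v ≤ (k : ℕ))),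
    sum_eq_zero (s := univ.filter (fun k : Fin w => v ≤ (k : ℕ))) (f := fun k => _ - _), add_zero]
  · rw [← sum_filter_add_sum_filter_not univ (fun k : Fin w => v ≤ (k : ℕ)), sub_eq_add_neg,
      ← sum_neg_distrib]
    simp only [not_le]
    congr 1
    · refine sum_congr rfl fun k hk => ?_
      rw [mul_div_assoc, cartan_term_of_le hϑ_odd hhbar t (mem_filter.mp hk).2]
      ring
    · refine sum_congr rfl fun k hk => ?_
      rw [mul_div_assoc, cartan_term_of_lt hϑ_odd hhbar t (mem_filter.mp hk).2]
      ring
  · intro k _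
    rw [← sum_sub_distrib]
    exact sum_eq_zero fun l _ => by ring
end
end

section
/- Residue identity encoding the relation EQ5 on the elliptic cohomology of T*Gr(v,w) (core of the §8 Proposition, part (2)): under the theta axioms, let w ≥ 1, 0 ≤ v ≤ w, and t₁,…,t_w, ħ, w₁, w₂, λ₁, λ₂ ∈ ℂ such that λ₁ + λ₂ = (2v−w)·ħ, the w+2 points t₁,…,t_w, −w₁, −w₂ are pairwise non-congruent modulo Λ, and δ := w₂ − w₁ ∉ Λ, λ₁ ∉ Λ, λ₂ ∉ Λ. Set g_μ(z) := ϑ(z+μ)/(ϑ(z)·ϑ(μ)), A(z) := ∏_{m=1}^{w} ϑ(z−t_m), and B(z) := ∏_{m=1}^{v} ϑ(z−t_m−ħ) · ∏_{m=v+1}^{w} ϑ(z−t_m+ħ). Then ∑_{k=1}^{w} g_{λ₁}(w₁+t_k)·g_{λ₂}(w₂+t_k)·B(t_k)/∏_{m≠k} ϑ(t_k−t_m) + g_{λ₂}(δ)·B(−w₁)/A(−w₁) + g_{λ₁}(−δ)·B(−w₂)/A(−w₂) = 0. -/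
noncomputable section

open Finset

/-- The lattice `ℤ + τℤ` in `ℂ`. -/
def lattice (τ : ℂ) : Set ℂ := {z : ℂ | ∃ n m : ℤ, z = (n : ℂ) + (m : ℂ) * τ}

/-- `g_μ(z) = ϑ(z+μ)/(ϑ(z)·ϑ(μ))`. -/
def gsec (ϑ : ℂ → ℂ) (mu z : ℂ) : ℂ := ϑ (z + mu) / (ϑ z * ϑ mu)

/-- `A(z) = ∏_{m=1}^{w} ϑ(z − t_m)`. -/
def Afun (ϑ : ℂ → ℂ) {w : ℕ} (t : Fin w → ℂ) (z : ℂ) : ℂ :=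
  ∏ m : Fin w, ϑ (z - t m)

/-- `B(z) = ∏_{m=1}^{v} ϑ(z − t_m − ħ) · ∏_{m=v+1}^{w} ϑ(z − t_m + ħ)` (0-indexed). -/
def Bfun (ϑ : ℂ → ℂ) (hbar : ℂ) {w : ℕ} (v : ℕ) (t : Fin w → ℂ) (z : ℂ) : ℂ :=
  (∏ m ∈ Finset.univ.filter (fun m : Fin w => (m : ℕ) < v), ϑ (z - t m - hbar)) *
    ∏ m ∈ Finset.univ.filter (fun m : Fin w => v ≤ (m : ℕ)), ϑ (z - t m + hbar)

open Filter Topology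

section ThetaResidues

variable {τ : ℂ} {ϑ : ℂ → ℂ}

/-- A function with periods `1` and `τ` is invariant under translation by the lattice. -/
lemma eq_of_mem_lattice {α : Type*} {f : ℂ → α} (h₁ : Function.Periodic f 1)
    (hτ : Function.Periodic f τ) {l : ℂ} (hl : l ∈ lattice τ) (z : ℂ) : f (z + l) = f z := by
  obtain ⟨n, m, rfl⟩ := hl
  have h := (h₁.int_mul n z)
  rw [mul_one] at h
  rw [← add_assoc, hτ.int_mul m, h]

/-- If all zeros of the entire function `D` are simple and are zeros of the entire function `H`,
then `D` divides `H` in the ring of entire functions. -/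
lemma exists_entire_quotient {H D : ℂ → ℂ} (hH : Differentiable ℂ H) (hD : Differentiable ℂ D)
    (hsimple : ∀ z, D z = 0 → deriv D z ≠ 0) (hzero : ∀ z, D z = 0 → H z = 0) :
    ∃ G : ℂ → ℂ, Differentiable ℂ G ∧ ∀ z, H z = D z * G z := by
  classical
  refine ⟨fun z => if D z = 0 then deriv H z / deriv D z else H z / D z, fun a => ?_, fun z => ?_⟩
  · by_cases ha : D a = 0
    · have dslope_diff : ∀ {f : ℂ → ℂ}, Differentiable ℂ f → DifferentiableAt ℂ (dslope f a) a :=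
        fun {f} hf => ((Complex.differentiableOn_dslope univ_mem).2
          hf.differentiableOn).differentiableAt univ_mem
      have hDa : dslope D a a ≠ 0 := by rw [dslope_same]; exact hsimple a ha
      refine ((dslope_diff hH).div (dslope_diff hD) hDa).congr_of_eventuallyEq ?_
      filter_upwards [(dslope_diff hD).continuousAt.eventually_ne hDa] with z hz
      rcases eq_or_ne z a with rfl | hza
      · simp [ha, dslope_same]
      · have h1 := sub_smul_dslope_of_zero ha z
        have h2 := sub_smul_dslope_of_zero (hzero a ha) z
        have hza' := sub_ne_zero.2 hza
        simp only [smul_eq_mul] at h1 h2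
        have hDz : D z ≠ 0 := by rw [← h1]; exact mul_ne_zero hza' hz
        simp only [hDz, if_false, Pi.div_apply]
        rw [← h1, ← h2, mul_div_mul_left _ _ hza']
    · refine ((hH a).div (hD a) ha).congr_of_eventuallyEq ?_
      filter_upwards [(hD a).continuousAt.eventually_ne ha] with z hz
      simp [hz]
  · by_cases hz : D z = 0
    · simp [hz, hzero z hz]
    · simp only [hz, if_false]
      field_simp

/-- An entire function all of whose zeros are simple is nonzero on a dense set. -/
lemma dense_ne_zero {D : ℂ → ℂ} (hD : Differentiable ℂ D)
    (hsimple : ∀ z, D z = 0 → deriv D z ≠ 0) : Dense {z | D z ≠ 0} := by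
  intro a
  by_cases ha : D a = 0
  · rw [mem_closure_iff_frequently]
    have h : ∀ᶠ z in 𝓝[≠] a, D z ≠ 0 :=
      (hD a).hasDerivAt.eventually_ne (hsimple a ha)
    exact h.frequently.filter_mono nhdsWithin_le_nhds
  · exact subset_closure ha

/-- A continuous function with periods `1` and `τ` is bounded. -/
lemma isBounded_range_of_periodic (hτ : 0 < τ.im) {f : ℂ → ℂ} (hf : Continuous f)
    (h₁ : Function.Periodic f 1) (h₂ : Function.Periodic f τ) :
    Bornology.IsBounded (Set.range f) := by
  let p : ℝ × ℝ → ℂ := fun x => f ((x.1 : ℂ) + (x.2 : ℂ) * τ)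
  have hp : Continuous p := by fun_prop
  refine ((isCompact_Icc.prod isCompact_Icc).image hp :
    IsCompact (p '' (Set.Icc (0 : ℝ) 1 ×ˢ Set.Icc (0 : ℝ) 1))).isBounded.subset ?_
  rintro _ ⟨z, rfl⟩
  set y : ℝ := z.im / τ.im with hy
  set x : ℝ := z.re - y * τ.re with hx
  have hz : z = (x : ℂ) + (y : ℂ) * τ := by
    apply Complex.ext
    · simp [hx]
    · simp [hy, hτ.ne']
  refine ⟨(Int.fract x, Int.fract y), ⟨⟨Int.fract_nonneg _, (Int.fract_lt_one _).le⟩,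
    ⟨Int.fract_nonneg _, (Int.fract_lt_one _).le⟩⟩, ?_⟩
  have hl : ((⌊x⌋ : ℤ) : ℂ) + ((⌊y⌋ : ℤ) : ℂ) * τ ∈ lattice τ := ⟨_, _, rfl⟩
  have h := eq_of_mem_lattice h₁ h₂ hl (((Int.fract x : ℝ) : ℂ) + ((Int.fract y : ℝ) : ℂ) * τ)
  show f _ = f z
  rw [← h]
  congr 1
  rw [hz]
  have hx' : (x : ℂ) = ((Int.fract x : ℝ) : ℂ) + ((⌊x⌋ : ℤ) : ℂ) := by
    exact_mod_cast (Int.fract_add_floor x).symm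
  have hy' : (y : ℂ) = ((Int.fract y : ℝ) : ℂ) + ((⌊y⌋ : ℤ) : ℂ) := by
    exact_mod_cast (Int.fract_add_floor y).symm
  linear_combination -hx' - τ * hy'

/-- An entire function with period `1` that is additively quasi-periodic with respect to `τ`
is `τ`-periodic. -/
lemma eq_zero_of_quasiperiodic (hτ : 0 < τ.im) {G : ℂ → ℂ} (hG : Differentiable ℂ G) {c : ℂ}
    (h₁ : ∀ z, G (z + 1) = G z) (h₂ : ∀ z, G (z + τ) = G z + c) : c = 0 := by
  have hd₁ : Function.Periodic (deriv G) 1 := fun z => by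
    rw [← deriv_comp_add_const]
    simp_rw [h₁]
  have hd₂ : Function.Periodic (deriv G) τ := fun z => by
    rw [← deriv_comp_add_const]
    simp_rw [h₂]
    simp
  have hconst := hG.deriv.apply_eq_apply_of_bounded
    (isBounded_range_of_periodic hτ hG.deriv.continuous hd₁ hd₂)
  have hlin : Differentiable ℂ fun z => G z - deriv G 0 * z := by fun_prop
  have hcst := is_const_of_deriv_eq_zero hlin fun z => by
    have h : HasDerivAt (fun z => G z - deriv G 0 * z) (deriv G z - deriv G 0 * 1) z :=
      (hG z).hasDerivAt.sub ((hasDerivAt_id z).const_mul _)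
    rw [h.deriv, hconst z 0]
    ring
  have e1 : G 1 - deriv G 0 * 1 = G 0 - deriv G 0 * 0 := hcst 1 0
  have e2 : G τ - deriv G 0 * τ = G 0 - deriv G 0 * 0 := hcst τ 0
  have e3 := h₁ 0
  have e4 := h₂ 0
  rw [zero_add] at e3 e4
  linear_combination e2 - e4 - τ * (e1 - e3)

variable {ι : Type*} [Fintype ι] [DecidableEq ι]

/-- Translation behaviour of the numerator of `N / D - ∑ i, r i * (ϑ' / ϑ) (z - p i)`, where
`D z = ∏ i, ϑ (z - p i)`, under a quasi-period `ω` of `ϑ`. -/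
lemma numerator_quasiperiodic {c : ℂ → ℂ} {ω κ : ℂ} {N : ℂ → ℂ} (p r : ι → ℂ)
    (hϑ : ∀ z, ϑ (z + ω) = c z * ϑ z)
    (hϑ' : ∀ z, deriv ϑ (z + ω) = c z * (deriv ϑ z + κ * ϑ z))
    (hN : ∀ z, N (z + ω) = (∏ i, c (z - p i)) * N z) (z : ℂ) :
    N (z + ω) - ∑ i, r i * (deriv ϑ (z + ω - p i) * ∏ j ∈ univ.erase i, ϑ (z + ω - p j)) =
      (∏ i, c (z - p i)) *
        ((N z - ∑ i, r i * (deriv ϑ (z - p i) * ∏ j ∈ univ.erase i, ϑ (z - p j))) -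
          κ * (∑ i, r i) * ∏ i, ϑ (z - p i)) := by
  have key : ∀ i, r i * (deriv ϑ (z + ω - p i) * ∏ j ∈ univ.erase i, ϑ (z + ω - p j)) =
      (∏ i, c (z - p i)) * (r i * (deriv ϑ (z - p i) * ∏ j ∈ univ.erase i, ϑ (z - p j)) +
        κ * r i * ∏ i, ϑ (z - p i)) := fun i => by
    simp_rw [add_sub_right_comm z ω, hϑ, hϑ', prod_mul_distrib]
    rw [← mul_prod_erase univ (fun i => c (z - p i)) (mem_univ i),
      ← mul_prod_erase univ (fun i => ϑ (z - p i)) (mem_univ i)]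
    ring
  simp_rw [key, hN, ← mul_sum, sum_add_distrib, ← sum_mul, ← mul_sum]
  ring

/-- The residues of an elliptic function `N z / ∏ i, ϑ (z - p i)` with simple poles at the
pairwise non-congruent points `p i` sum to zero. -/
lemma sum_residues_eq_zero (hτ : 0 < τ.im) (hϑ : Differentiable ℂ ϑ)
    (hzero : ∀ z, ϑ z = 0 ↔ z ∈ lattice τ) (hderiv : deriv ϑ 0 = 1) {c₁ c₂ : ℂ → ℂ} {κ : ℂ}
    (hc₁ : ∀ z, c₁ z ≠ 0) (hc₂ : ∀ z, c₂ z ≠ 0) (hκ : κ ≠ 0)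
    (h₁ : ∀ z, ϑ (z + 1) = c₁ z * ϑ z) (h₂ : ∀ z, ϑ (z + τ) = c₂ z * ϑ z)
    (h₁' : ∀ z, deriv ϑ (z + 1) = c₁ z * deriv ϑ z)
    (h₂' : ∀ z, deriv ϑ (z + τ) = c₂ z * (deriv ϑ z + κ * ϑ z))
    (p : ι → ℂ) (hp : ∀ i j, i ≠ j → p i - p j ∉ lattice τ)
    {N : ℂ → ℂ} (hN : Differentiable ℂ N)
    (hN₁ : ∀ z, N (z + 1) = (∏ i, c₁ (z - p i)) * N z)
    (hN₂ : ∀ z, N (z + τ) = (∏ i, c₂ (z - p i)) * N z) :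
    ∑ i, N (p i) / ∏ j ∈ univ.erase i, ϑ (p i - p j) = 0 := by
  set r : ι → ℂ := fun i => N (p i) / ∏ j ∈ univ.erase i, ϑ (p i - p j) with hr
  set D : ℂ → ℂ := fun z => ∏ i, ϑ (z - p i) with hDdef
  set H : ℂ → ℂ := fun z =>
    N z - ∑ i, r i * (deriv ϑ (z - p i) * ∏ j ∈ univ.erase i, ϑ (z - p j)) with hHdef
  have hT : ∀ s : Finset ι, Differentiable ℂ fun z => ∏ j ∈ s, ϑ (z - p j) := fun s =>
    Differentiable.fun_finsetProd fun i _ => by fun_prop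
  have hD : Differentiable ℂ D := hT univ
  have hH : Differentiable ℂ H := by
    refine hN.sub (Differentiable.fun_sum fun i _ => ?_)
    have h := hϑ.deriv
    exact ((h.comp (differentiable_id.sub_const (p i))).mul (hT _)).const_mul (r i)
  have hD₁ : ∀ z, D (z + 1) = (∏ i, c₁ (z - p i)) * D z := fun z => by
    simp_rw [hDdef, add_sub_right_comm z 1, h₁, prod_mul_distrib]
  have hD₂ : ∀ z, D (z + τ) = (∏ i, c₂ (z - p i)) * D z := fun z => by
    simp_rw [hDdef, add_sub_right_comm z τ, h₂, prod_mul_distrib]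
  have hH₁ : ∀ z, H (z + 1) = (∏ i, c₁ (z - p i)) * H z := fun z => by
    have h := numerator_quasiperiodic (κ := 0) p r h₁ (by simpa using h₁') hN₁ z
    simpa using h
  have hH₂ : ∀ z, H (z + τ) = (∏ i, c₂ (z - p i)) * (H z - κ * (∑ i, r i) * D z) :=
    numerator_quasiperiodic p r h₂ h₂' hN₂
  have hC₁ : ∀ z, ∏ i, c₁ (z - p i) ≠ 0 := fun z => prod_ne_zero_iff.2 fun i _ => hc₁ _
  have hC₂ : ∀ z, ∏ i, c₂ (z - p i) ≠ 0 := fun z => prod_ne_zero_iff.2 fun i _ => hc₂ _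
  have hT_ne : ∀ i l, l ∈ lattice τ → ∏ j ∈ univ.erase i, ϑ (p i + l - p j) ≠ 0 := by
    intro i l hl
    refine prod_ne_zero_iff.2 fun j hj h => hp i j (ne_of_mem_erase hj).symm ?_
    have hper : (ϑ (p i - p j + l) = 0) = (ϑ (p i - p j) = 0) :=
      eq_of_mem_lattice (f := fun z => ϑ z = 0) (fun z => by simp [h₁, hc₁])
        (fun z => by simp [h₂, hc₂]) hl _
    rw [← hzero, ← hper, ← add_sub_right_comm]
    exact h
  have hϑ₀ : ϑ 0 = 0 := (hzero 0).2 ⟨0, 0, by simp⟩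
  have hϑ_simple : ∀ l ∈ lattice τ, deriv ϑ l ≠ 0 := by
    intro l hl h
    have hper := eq_of_mem_lattice (f := fun z => ϑ z = 0 ∧ deriv ϑ z = 0)
      (fun z => by simp [h₁, h₁', hc₁])
      (fun z => by
        simp only [h₂, h₂', hc₂, mul_eq_zero, false_or, eq_iff_iff]
        exact and_congr_right fun h => by simp [h]) hl 0
    rw [zero_add] at hper
    have h0 := (hper.mp ⟨(hzero l).2 hl, h⟩).2
    rw [hderiv] at h0
    exact one_ne_zero h0
  have hroot : ∀ z, D z = 0 → ∃ i, ∃ l ∈ lattice τ, z = p i + l := by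
    intro z hz
    obtain ⟨i, -, hi⟩ := prod_eq_zero_iff.1 hz
    exact ⟨i, z - p i, (hzero _).1 hi, by ring⟩
  have hsimple : ∀ z, D z = 0 → deriv D z ≠ 0 := by
    intro z hz
    obtain ⟨i, l, hl, rfl⟩ := hroot z hz
    have hDi : D = fun z => ϑ (z - p i) * ∏ j ∈ univ.erase i, ϑ (z - p j) :=
      funext fun z => (mul_prod_erase univ (fun j => ϑ (z - p j)) (mem_univ i)).symm
    rw [hDi, deriv_fun_mul (by fun_prop) (hT _ _), deriv_comp_sub_const, add_sub_cancel_left,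
      (hzero l).2 hl, zero_mul, add_zero]
    exact mul_ne_zero (hϑ_simple l hl) (hT_ne i l hl)
  have hDp : ∀ i, D (p i) = 0 := fun i => prod_eq_zero (mem_univ i) (by simp [hϑ₀])
  have hHp : ∀ i, H (p i) = 0 := by
    intro i
    have hne := hT_ne i 0 ⟨0, 0, by simp⟩
    rw [add_zero] at hne
    simp only [hHdef]
    rw [Fintype.sum_eq_single i]
    · rw [sub_self, hderiv, one_mul, hr]
      simp only
      rw [div_mul_cancel₀ _ hne, sub_self]
    · intro k hk
      rw [prod_eq_zero (mem_erase.2 ⟨hk.symm, mem_univ i⟩) (by simp [hϑ₀]), mul_zero, mul_zero]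
  have hHD : ∀ z, D z = 0 → H z = 0 := by
    intro z hz
    obtain ⟨i, l, hl, rfl⟩ := hroot z hz
    have hper := eq_of_mem_lattice (f := fun z => D z = 0 ∧ H z = 0)
      (fun z => by simp [hD₁, hH₁, hC₁])
      (fun z => by
        simp only [hD₂, hH₂, hC₂, mul_eq_zero, false_or, eq_iff_iff]
        exact and_congr_right fun h => by simp [h]) hl (p i)
    exact (hper.mpr ⟨hDp i, hHp i⟩).2
  obtain ⟨G, hG, hHG⟩ := exists_entire_quotient hH hD hsimple hHD
  have hdense := dense_ne_zero hD hsimple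
  have hG₁ : ∀ z, G (z + 1) = G z := by
    refine congrFun (Continuous.ext_on hdense (hG.continuous.comp (continuous_add_const 1))
      hG.continuous fun z (hz : D z ≠ 0) => ?_)
    have h := hH₁ z
    rw [hHG, hHG z, hD₁] at h
    exact mul_left_cancel₀ (mul_ne_zero (hC₁ z) hz) (by linear_combination h)
  have hG₂ : ∀ z, G (z + τ) = G z + -(κ * ∑ i, r i) := by
    refine congrFun (Continuous.ext_on hdense (hG.continuous.comp (continuous_add_const τ))
      (hG.continuous.add continuous_const) fun z (hz : D z ≠ 0) => ?_)
    have h := hH₂ z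
    rw [hHG, hHG z, hD₂] at h
    exact mul_left_cancel₀ (mul_ne_zero (hC₂ z) hz) (by linear_combination h)
  have h := eq_zero_of_quasiperiodic hτ hG hG₁ hG₂
  exact (mul_eq_zero.1 (neg_eq_zero.1 h)).resolve_left hκ

/-- The theta function identity
`∑ i, (∏ j, ϑ (p i - p j + s j)) / ∏ j ≠ i, ϑ (p i - p j) = 0` for shifts `s` with sum zero. -/
lemma sum_theta_shift_eq_zero (hτ : 0 < τ.im) (hϑ : Differentiable ℂ ϑ)
    (hzero : ∀ z, ϑ z = 0 ↔ z ∈ lattice τ) (hderiv : deriv ϑ 0 = 1)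
    (h₁ : ∀ z, ϑ (z + 1) = -ϑ z)
    (h₂ : ∀ z, ϑ (z + τ) = -Complex.exp (-(Real.pi : ℂ) * Complex.I * τ) *
      Complex.exp (-2 * (Real.pi : ℂ) * Complex.I * z) * ϑ z)
    (p s : ι → ℂ) (hp : ∀ i j, i ≠ j → p i - p j ∉ lattice τ) (hs : ∑ i, s i = 0) :
    ∑ i, (∏ j, ϑ (p i - p j + s j)) / ∏ j ∈ univ.erase i, ϑ (p i - p j) = 0 := by
  set a : ℂ := -2 * (Real.pi : ℂ) * Complex.I with ha
  set b : ℂ := -Complex.exp (-(Real.pi : ℂ) * Complex.I * τ) with hb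
  have hexp : ∀ z, HasDerivAt (fun z => b * Complex.exp (a * z)) (b * Complex.exp (a * z) * a) z :=
    fun z => by
      have h := (((hasDerivAt_id z).const_mul a).cexp).const_mul b
      simpa [mul_assoc] using h
  refine sum_residues_eq_zero (c₁ := fun _ => -1) (c₂ := fun z => b * Complex.exp (a * z))
    (κ := a) (N := fun z => ∏ j, ϑ (z - p j + s j)) hτ hϑ hzero hderiv (by simp)
    (by simp [hb]) (by simp [ha]) (by simpa using h₁) h₂ ?_ ?_ p hp ?_ ?_ ?_
  · intro z
    rw [← deriv_comp_add_const]
    simp_rw [h₁]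
    simp
  · intro z
    rw [← deriv_comp_add_const]
    simp_rw [h₂]
    rw [((hexp z).fun_mul (hϑ z).hasDerivAt).deriv]
    ring
  · exact Differentiable.fun_finsetProd fun i _ => by fun_prop
  · intro z
    rw [← prod_mul_distrib]
    refine prod_congr rfl fun i _ => ?_
    rw [show z + 1 - p i + s i = z - p i + s i + 1 by ring, h₁, neg_one_mul]
  · intro z
    have hprod : ∏ i, Complex.exp (a * s i) = 1 := by
      rw [← Complex.exp_sum, ← mul_sum, hs, mul_zero, Complex.exp_zero]
    rw [← one_mul (∏ i, b * _), ← hprod, ← prod_mul_distrib, ← prod_mul_distrib]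
    refine prod_congr rfl fun i _ => ?_
    rw [show z + τ - p i + s i = z - p i + s i + τ by ring, h₂, mul_add, Complex.exp_add]
    ring

lemma prod_univ_erase_some (f : Option ι → ℂ) (i : ι) :
    ∏ j ∈ univ.erase (some i), f j = f none * ∏ j ∈ univ.erase i, f (some j) := by
  have h : (univ.erase (some i) : Finset (Option ι)) = insertNone (univ.erase i) := by
    ext (_ | j) <;> simp
  rw [h, prod_insertNone]

lemma prod_univ_erase_none (f : Option ι → ℂ) :
    ∏ j ∈ univ.erase none, f j = ∏ j, f (some j) := by
  have h : (univ.erase none : Finset (Option ι)) = univ.map Function.Embedding.some := by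
    ext (_ | j) <;> simp
  rw [h, prod_map]
  rfl

/-- `Bfun` as a single product. -/
lemma Bfun_eq_prod (hbar : ℂ) {w : ℕ} (v : ℕ) (t : Fin w → ℂ) (z : ℂ) :
    Bfun ϑ hbar v t z = ∏ m : Fin w, ϑ (z - t m + if (m : ℕ) < v then -hbar else hbar) := by
  rw [Bfun, ← prod_filter_mul_prod_filter_not univ (fun m : Fin w => (m : ℕ) < v)]
  simp_rw [not_lt]
  congr 1 <;> refine prod_congr rfl fun m hm => ?_
  · rw [if_pos (mem_filter.1 hm).2, sub_eq_add_neg]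
  · rw [if_neg (not_lt.2 (mem_filter.1 hm).2)]

lemma sum_shift (hbar : ℂ) {w v : ℕ} (hv : v ≤ w) :
    ∑ m : Fin w, (if (m : ℕ) < v then -hbar else hbar) = ((w : ℂ) - 2 * v) * hbar := by
  rw [Fin.sum_univ_eq_sum_range (fun m => if m < v then -hbar else hbar) w,
    ← sum_range_add_sum_Ico _ hv, sum_congr rfl fun m hm => if_pos (mem_range.1 hm),
    sum_congr rfl fun m hm => if_neg (not_lt.2 (mem_Ico.1 hm).1)]
  simp only [sum_const, card_range, Nat.card_Ico, nsmul_eq_mul, Nat.cast_sub hv]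
  ring

end ThetaResidues

/-- Residue identity encoding the relation EQ5 on the elliptic cohomology of
`T*Gr(v,w)` (core of the §8 Proposition, part (2)): the residues of the elliptic
function `g_{λ₁}(z+w₁)·g_{λ₂}(z+w₂)·B(z)/A(z)` sum to zero. -/
theorem residue_identity_EQ5
    (τ : ℂ) (hτ : 0 < τ.im)
    (ϑ : ℂ → ℂ)
    (hϑ_hol : Differentiable ℂ ϑ)
    (hϑ_zero : ∀ z : ℂ, ϑ z = 0 ↔ z ∈ lattice τ)
    (hϑ_deriv : deriv ϑ 0 = 1)
    (hϑ_per1 : ∀ z : ℂ, ϑ (z + 1) = -ϑ z)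
    (hϑ_odd : ∀ z : ℂ, ϑ (-z) = -ϑ z)
    (hϑ_perτ : ∀ z : ℂ, ϑ (z + τ) =
      -Complex.exp (-(Real.pi : ℂ) * Complex.I * τ) *
        Complex.exp (-2 * (Real.pi : ℂ) * Complex.I * z) * ϑ z)
    (w v : ℕ) (hw : 1 ≤ w) (hv : v ≤ w)
    (t : Fin w → ℂ) (hbar w₁ w₂ lam₁ lam₂ : ℂ)
    (hlam : lam₁ + lam₂ = (2 * (v : ℂ) - (w : ℂ)) * hbar)
    (h_tt : ∀ k m : Fin w, k ≠ m → t k - t m ∉ lattice τ)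
    (h_tw₁ : ∀ k : Fin w, t k - (-w₁) ∉ lattice τ)
    (h_tw₂ : ∀ k : Fin w, t k - (-w₂) ∉ lattice τ)
    (hδ : w₂ - w₁ ∉ lattice τ)
    (hlam₁ : lam₁ ∉ lattice τ) (hlam₂ : lam₂ ∉ lattice τ) :
    (∑ k : Fin w,
      gsec ϑ lam₁ (w₁ + t k) * gsec ϑ lam₂ (w₂ + t k) * Bfun ϑ hbar v t (t k) /
        ∏ m ∈ Finset.univ.erase k, ϑ (t k - t m))
    + gsec ϑ lam₂ (w₂ - w₁) * Bfun ϑ hbar v t (-w₁) / Afun ϑ t (-w₁)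
    + gsec ϑ lam₁ (-(w₂ - w₁)) * Bfun ϑ hbar v t (-w₂) / Afun ϑ t (-w₂) = 0 := by
  have hϑ₁ : ϑ lam₁ ≠ 0 := fun h => hlam₁ ((hϑ_zero _).1 h)
  have hϑ₂ : ϑ lam₂ ≠ 0 := fun h => hlam₂ ((hϑ_zero _).1 h)
  have hneg : ∀ z, -z ∈ lattice τ → z ∈ lattice τ := fun z h => by
    rw [← hϑ_zero, hϑ_odd, neg_eq_zero] at h
    exact (hϑ_zero z).1 h
  let p : Option (Option (Fin w)) → ℂ := fun i => i.elim (-w₁) fun i => i.elim (-w₂) t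
  let s : Option (Option (Fin w)) → ℂ := fun i => i.elim lam₁ fun i => i.elim lam₂ fun m =>
    if (m : ℕ) < v then -hbar else hbar
  have hp : ∀ i j, i ≠ j → p i - p j ∉ lattice τ := by
    rintro (_ | _ | i) (_ | _ | j) hij
    · exact absurd rfl hij
    · intro h
      exact hδ (by simpa [p, neg_add_eq_sub] using h)
    · exact fun h => h_tw₁ j (hneg _ (by rw [neg_sub]; exact h))
    · intro h
      exact hδ (hneg _ (by simpa [p, neg_add_eq_sub] using h))
    · exact absurd rfl hij
    · exact fun h => h_tw₂ j (hneg _ (by rw [neg_sub]; exact h))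
    · exact h_tw₁ i
    · exact h_tw₂ i
    · exact h_tt i j fun h => hij (by rw [h])
  have hs : ∑ i, s i = 0 := by
    simp only [Fintype.sum_option, s, Option.elim]
    rw [sum_shift hbar hv]
    linear_combination hlam
  have key := sum_theta_shift_eq_zero hτ hϑ_hol hϑ_zero hϑ_deriv hϑ_per1 hϑ_perτ p s hp hs
  simp only [Fintype.sum_option, Fintype.prod_option, prod_univ_erase_none, prod_univ_erase_some,
    p, s, Option.elim, ← Bfun_eq_prod, sub_self, zero_add] at key
  have hterm : ∀ k, ϑ lam₁ * ϑ lam₂ * (gsec ϑ lam₁ (w₁ + t k) * gsec ϑ lam₂ (w₂ + t k) *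
        Bfun ϑ hbar v t (t k) / ∏ m ∈ Finset.univ.erase k, ϑ (t k - t m)) =
      ϑ (t k - -w₁ + lam₁) * (ϑ (t k - -w₂ + lam₂) * Bfun ϑ hbar v t (t k)) /
        (ϑ (t k - -w₁) * (ϑ (t k - -w₂) * ∏ j ∈ univ.erase k, ϑ (t k - t j))) := fun k => by
    rw [gsec, gsec, sub_neg_eq_add, sub_neg_eq_add, add_comm w₁, add_comm w₂]
    field_simp
  have hterm₁ : ϑ lam₁ * ϑ lam₂ * (gsec ϑ lam₂ (w₂ - w₁) * Bfun ϑ hbar v t (-w₁) /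
        Afun ϑ t (-w₁)) =
      ϑ lam₁ * (ϑ (-w₁ - -w₂ + lam₂) * Bfun ϑ hbar v t (-w₁)) /
        (ϑ (-w₁ - -w₂) * ∏ j, ϑ (-w₁ - t j)) := by
    rw [gsec, Afun, neg_sub_neg]
    field_simp
  have hterm₂ : ϑ lam₁ * ϑ lam₂ * (gsec ϑ lam₁ (-(w₂ - w₁)) * Bfun ϑ hbar v t (-w₂) /
        Afun ϑ t (-w₂)) =
      ϑ (-w₂ - -w₁ + lam₁) * (ϑ lam₂ * Bfun ϑ hbar v t (-w₂)) /
        (ϑ (-w₂ - -w₁) * ∏ j, ϑ (-w₂ - t j)) := by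
    rw [gsec, Afun, neg_sub_neg, neg_sub]
    field_simp
  rw [← mul_right_inj' (mul_ne_zero hϑ₁ hϑ₂), mul_zero, ← key, mul_add, mul_add, mul_sum,
    hterm₁, hterm₂, sum_congr rfl fun k _ => hterm k]
  ring
end
end
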